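/- arXiv:1901.11154 — 2 statements merged into one kernel-verified Lean document; each statement's English description precedes it below -/
import Mathlib

section
/- For all integers r >= 3 and s >= 1 with 2*s <= r, the inequality F(2,r,s) < 6 + 12/((r+1)*s + 1) holds if and only if r^2 + 1 < s*(3*r - 1). -/
/-- The integer polynomial `P(m,r,s)` (numerator data of the slope function). -/
def P (m r s : ℤ) : ℤ :=
  m^2*r^5*s^4 - m^2*r^5*s^2 + 3*m^2*r^4*s^4 + 5*m^2*r^4*s^3 + m^2*r^4*s^2 - m^2*r^4*s
  + m^2*r^3*s^4 + 12*m^2*r^3*s^3 + 13*m^2*r^3*s^2 - 2*m^2*r^3*s - 4*m^2*r^3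
  - 3*m^2*r^2*s^4 - 5*m^2*r^2*s^3 + m^2*r^2*s^2 + 3*m^2*r^2*s
  - 2*m^2*r*s^4 - 12*m^2*r*s^3 - 14*m^2*r*s^2 + 4*m^2*r
  - m*r^5*s^4 + m*r^5*s^2 - 5*m*r^4*s^4 - 5*m*r^4*s^3 - m*r^4*s^2 + m*r^4*s
  - 9*m*r^3*s^4 - 26*m*r^3*s^3 - 13*m*r^3*s^2 + 22*m*r^3*s + 4*m*r^3
  - 7*m*r^2*s^4 - 37*m*r^2*s^3 - 5*m*r^2*s^2 + 57*m*r^2*s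
  - 2*m*r*s^4 - 16*m*r*s^3 + 6*m*r*s^2 + 40*m*r*s - 4*m*r
  + 2*r^4*s^2 + 2*r^3*s^3 + 8*r^3*s^2 - 6*r^3*s
  + 6*r^2*s^3 + 6*r^2*s^2 - 18*r^2*s + 4*r^2
  + 6*r*s^3 - 4*r*s^2 - 14*r*s + 8*r + 2*s^3 - 4*s^2 - 2*s + 4

/-- The integer polynomial `Q(m,r,s)` (denominator data of the slope function). -/
def Q (m r s : ℤ) : ℤ :=
  m*r^3*s^3 - m*r^3*s^2 + 2*m*r^2*s^3 + m*r^2*s^2 - m*r*s^3 + 5*m*r*s^2 + m*r*s - 2*m*r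
  - 2*m*s^3 - 5*m*s^2 - m*s + 2*m - r^3*s^3 + r^3*s^2 - 4*r^2*s^3 + r^2*s^2 - 5*r*s^3
  - 7*r*s^2 + 7*r*s + 2*r - 2*s^3 - 7*s^2 + 17*s - 2

/-- The slope function `F(m,r,s) = 6 P(m,r,s) / (m r (r+1) (s+1) Q(m,r,s))`, as a real number. -/
noncomputable def F (m r s : ℤ) : ℝ :=
  6 * (P m r s : ℝ) / ((m * r * (r + 1) * (s + 1) * Q m r s : ℤ) : ℝ)

theorem Q_two_pos {r s : ℤ} (hs : 1 ≤ s) (hrs : 2 * s ≤ r) : 0 < Q 2 r s := by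
  obtain ⟨u, rfl⟩ : ∃ u, s = u + 1 := ⟨s - 1, by ring⟩
  obtain ⟨t, rfl⟩ : ∃ t, r = 2 * (u + 1) + t := ⟨r - 2 * (u + 1), by ring⟩
  have hu : 0 ≤ u := by linarith
  have ht : 0 ≤ t := by linarith
  unfold Q
  ring_nf
  positivity

/-- The positive cofactor of `r ^ 2 + 1 - s * (3 * r - 1)` in the cleared-denominator form of the
inequality `F 2 r s < 6 + 12 / ((r + 1) * s + 1)`. -/
def slopeCofactor (r s : ℤ) : ℤ :=
  r^3*s^2 + r^2*s^3 + 3*r^2*s^2 - 3*r^2*s + 2*r*s^3 - 6*r*s + 2*r + s^3 - 2*s^2 - s + 2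

theorem slopeCofactor_pos {r s : ℤ} (hr : 3 ≤ r) (hs : 1 ≤ s) : 0 < slopeCofactor r s := by
  obtain ⟨u, rfl⟩ : ∃ u, s = u + 1 := ⟨s - 1, by ring⟩
  obtain ⟨t, rfl⟩ : ∃ t, r = t + 3 := ⟨r - 3, by ring⟩
  have hu : 0 ≤ u := by linarith
  have ht : 0 ≤ t := by linarith
  unfold slopeCofactor
  ring_nf
  positivity

theorem P_two_mul_sub (r s : ℤ) :
    P 2 r s * ((r + 1) * s + 1) - ((r + 1) * s + 3) * (2 * r * (r + 1) * (s + 1) * Q 2 r s) =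
      2 * slopeCofactor r s * (r ^ 2 + 1 - s * (3 * r - 1)) := by
  unfold P Q slopeCofactor
  ring

theorem stmt3 (r s : ℤ) (hr : 3 ≤ r) (hs : 1 ≤ s) (hrs : 2 * s ≤ r) :
    F 2 r s < 6 + 12 / (((r : ℝ) + 1) * (s : ℝ) + 1) ↔ r ^ 2 + 1 < s * (3 * r - 1) := by
  have hG : 0 < (r + 1) * s + 1 := by nlinarith
  have hD : 0 < 2 * r * (r + 1) * (s + 1) * Q 2 r s := by
    have := Q_two_pos hs hrs
    have : 0 < r := by linarith
    have : 0 < s := by linarith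
    positivity
  have hGR : (0 : ℝ) < ((r : ℝ) + 1) * s + 1 := by exact_mod_cast hG
  have hbound : (6 : ℝ) + 12 / (((r : ℝ) + 1) * s + 1) =
      6 * (((r : ℝ) + 1) * s + 3) / (((r : ℝ) + 1) * s + 1) := by
    field_simp
    ring
  have hclear : F 2 r s < 6 + 12 / (((r : ℝ) + 1) * (s : ℝ) + 1) ↔
      6 * P 2 r s * ((r + 1) * s + 1) <
        6 * ((r + 1) * s + 3) * (2 * r * (r + 1) * (s + 1) * Q 2 r s) := by
    rw [hbound, F, div_lt_div_iff₀ (by exact_mod_cast hD) hGR]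
    exact_mod_cast Iff.rfl
  have hfactor := P_two_mul_sub r s
  have hA := slopeCofactor_pos hr hs
  rw [hclear]
  constructor
  · intro h
    by_contra! hle
    have := mul_nonneg hA.le (sub_nonneg.mpr hle)
    linarith
  · intro h
    have := mul_pos hA (sub_pos.mpr h)
    linarith
end

section
/- For all integers m >= 2, r >= 3, s >= 1 such that choose(r+m, m) >= m*r*(s+1) - (r+1)*s + 1, the real number F(m,r,s) satisfies F(m,r,s) > 6 + 8/((r+1)*s + 1). -/
/-- The numerator of `F m r s - (6 + 8 / (g + 1))`, up to a factor of two, where `g = (r + 1) s`. -/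
def slopeExcess (m r s : ℤ) : ℤ :=
  3 * ((r + 1) * s + 1) * P m r s
    - (3 * ((r + 1) * s + 1) + 4) * (m * r * (r + 1) * (s + 1) * Q m r s)

theorem slope_gt_of_pos {m r s : ℤ} (hm : 0 < m) (hr : 0 < r) (hs : 0 < s)
    (hQ : 0 < Q m r s) (hE : 0 < slopeExcess m r s) :
    F m r s > 6 + 8 / (((r : ℝ) + 1) * (s : ℝ) + 1) := by
  have hg : (0 : ℝ) < ((r : ℝ) + 1) * s + 1 := by
    exact_mod_cast (by positivity : 0 < (r + 1) * s + 1)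
  have hD : 0 < m * r * (r + 1) * (s + 1) * Q m r s := by positivity
  unfold slopeExcess at hE
  unfold F
  generalize m * r * (r + 1) * (s + 1) * Q m r s = D at hD hE ⊢
  have hD' : (0 : ℝ) < D := by exact_mod_cast hD
  have hE' : (0 : ℝ) < 3 * (((r : ℝ) + 1) * s + 1) * P m r s
      - (3 * (((r : ℝ) + 1) * s + 1) + 4) * D := by
    exact_mod_cast hE
  rw [gt_iff_lt, ← sub_pos]
  have key : 6 * (P m r s : ℝ) / D - (6 + 8 / (((r : ℝ) + 1) * s + 1))
      = 2 * (3 * (((r : ℝ) + 1) * s + 1) * P m r s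
          - (3 * (((r : ℝ) + 1) * s + 1) + 4) * D) / (D * (((r : ℝ) + 1) * s + 1)) := by
    field_simp
    ring
  rw [key]
  positivity

/-- Both polynomials have only positive coefficients in the variables `m - 3`, `r - 3`, `s - 1`. -/
theorem pos_of_three_le {m r s : ℤ} (hm : 3 ≤ m) (hr : 3 ≤ r) (hs : 1 ≤ s) :
    0 < Q m r s ∧ 0 < slopeExcess m r s := by
  obtain ⟨a, rfl⟩ := Int.le.dest hm
  obtain ⟨b, rfl⟩ := Int.le.dest hr
  obtain ⟨c, rfl⟩ := Int.le.dest hs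
  unfold slopeExcess P Q
  constructor <;> ring_nf <;> positivity

theorem pos_two_of_five_le {r s : ℤ} (hr : 5 ≤ r) (hs : 1 ≤ s) :
    0 < Q 2 r s ∧ 0 < slopeExcess 2 r s := by
  obtain ⟨b, rfl⟩ := Int.le.dest hr
  obtain ⟨c, rfl⟩ := Int.le.dest hs
  unfold slopeExcess P Q
  constructor <;> ring_nf <;> positivity

theorem pos_two_four {s : ℤ} (hs : 1 ≤ s) :
    0 < Q 2 4 s ∧ 0 < slopeExcess 2 4 s := by
  rcases hs.eq_or_lt with rfl | hs
  · decide
  obtain ⟨c, rfl⟩ := Int.le.dest (Int.add_one_le_of_lt hs)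
  unfold slopeExcess P Q
  constructor <;> ring_nf <;> positivity

theorem stmt4 (m r s : ℤ) (hm : 2 ≤ m) (hr : 3 ≤ r) (hs : 1 ≤ s)
    (hch : m * r * (s + 1) - (r + 1) * s + 1 ≤ ((r + m).toNat.choose m.toNat : ℤ)) :
    F m r s > 6 + 8 / (((r : ℝ) + 1) * (s : ℝ) + 1) := by
  suffices h : 0 < Q m r s ∧ 0 < slopeExcess m r s from
    slope_gt_of_pos (by lia) (by lia) (by lia) h.1 h.2
  rcases hm.eq_or_lt with rfl | hm
  · rcases hr.eq_or_lt with rfl | hr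
    · have hchoose : ((3 + 2 : ℤ).toNat.choose (2 : ℤ).toNat : ℤ) = 10 := by decide
      obtain rfl : s = 1 := by lia
      decide
    rcases (Int.add_one_le_of_lt hr).eq_or_lt with rfl | hr
    · exact pos_two_four hs
    · exact pos_two_of_five_le hr hs
  · exact pos_of_three_le hm hr hs
end
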